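/- Let R be a ring, σ a 2-term complex in K^b(Proj R) (a complex of projective right R-modules concentrated in degrees −1 and 0), and T = H^0(σ). If the class D_σ is closed under coproducts in Mod R, then the class Y_σ is closed under coproducts in Mod R, and the class σ^{⊥>0} = {Y ∈ D(R) : Hom_{D(R)}(σ, Y[i]) = 0 for all i > 0} is closed under coproducts in D(R). -/

import Mathlib

open CategoryTheory Limits Pretriangulated

universe u

namespace Glue

noncomputable section

variable (R : Type u) [Ring R]

instance hasDerivedCategoryModule : HasDerivedCategory (ModuleCat.{u} R) :=
  HasDerivedCategory.standard _

variable {R}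

/-- A class of objects is closed under (set-indexed) coproducts. -/
def ClosedUnderCoproducts {C : Type*} [Category C] (S : Set C) : Prop :=
  ∀ (J : Type*) (f : J → C) (c : Cofan f), IsColimit c → (∀ j, f j ∈ S) → c.pt ∈ S

/-- A 2-term complex of projectives: a cochain complex of projective modules
concentrated in degrees `-1` and `0`. -/
def TwoTermProj (σ : CochainComplex (ModuleCat.{u} R) ℤ) : Prop :=
  (∀ n : ℤ, Projective (σ.X n)) ∧ (∀ n : ℤ, n ≠ -1 → n ≠ 0 → IsZero (σ.X n))

/-- The class `D_σ` of modules `M` such that `Hom_R(σ, M)` is surjective. -/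
def Dclass (σ : CochainComplex (ModuleCat.{u} R) ℤ) : Set (ModuleCat.{u} R) :=
  {M | Function.Surjective (fun φ : σ.X 0 ⟶ M => σ.d (-1) 0 ≫ φ)}

/-- The class `Y_σ` of modules `M` such that `Hom_R(σ, M)` is bijective. -/
def Yclass (σ : CochainComplex (ModuleCat.{u} R) ℤ) : Set (ModuleCat.{u} R) :=
  {M | Function.Bijective (fun φ : σ.X 0 ⟶ M => σ.d (-1) 0 ≫ φ)}

section Abelian

universe w v u₁

variable {C : Type u₁} [Category.{v} C] [Abelian C]

/-- A complex concentrated in one degree with an injective value is K-injective. -/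
lemma isKInjective_single (E : C) [Injective E] (n : ℤ) :
    CochainComplex.IsKInjective ((HomologicalComplex.single C (ComplexShape.up ℤ) n).obj E) := by
  have : CochainComplex.IsStrictlyGE ((HomologicalComplex.single C (.up ℤ) n).obj E) n := by
    rw [CochainComplex.isStrictlyGE_iff]
    exact fun i hi ↦ HomologicalComplex.isZero_single_obj_X _ _ _ _ hi.ne
  have (m : ℤ) : Injective (((HomologicalComplex.single C (.up ℤ) n).obj E).X m) := by
    by_cases h : m = n
    · subst h
      exact Injective.of_iso (HomologicalComplex.singleObjXSelf (.up ℤ) m E).symm inferInstance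
    · exact Injective.of_iso (HomologicalComplex.isZero_single_obj_X (.up ℤ) n E m h).isoZero.symm
        inferInstance
  exact CochainComplex.isKInjective_of_injective _ n

/-- A morphism to an injective object placed in degree `n` is null-homotopic as soon as it
vanishes on the homology in degree `n`. -/
lemma nonempty_homotopy_zero_of_homologyMap_eq_zero {K : CochainComplex C ℤ} {E : C} [Injective E]
    {n : ℤ} (ψ : K ⟶ (HomologicalComplex.single C (.up ℤ) n).obj E)
    (hψ : HomologicalComplex.homologyMap ψ n = 0) : Nonempty (Homotopy ψ 0) := by
  let F := (HomologicalComplex.single C (.up ℤ) n).obj E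
  have hF (m : ℤ) (hm : m ≠ n) : IsZero (F.X m) :=
    HomologicalComplex.isZero_single_obj_X _ _ _ _ hm
  have hinj : Injective (F.X n) :=
    Injective.of_iso (HomologicalComplex.singleObjXSelf (.up ℤ) n E).symm inferInstance
  have hprev : (ComplexShape.up ℤ).prev n = n - 1 := by simp
  have hnext : (ComplexShape.up ℤ).next n = n + 1 := by simp
  let q : K.opcycles n ⟶ F.X n := K.descOpcycles (ψ.f n) (n - 1) hprev (by
    rw [← ψ.comm, (hF (n - 1) (by lia)).eq_of_tgt (ψ.f (n - 1)) 0, zero_comp])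
  have hq : K.homologyι n ≫ q = 0 := by
    have : IsIso (F.pOpcycles n) := F.isIso_pOpcycles (n - 1) n hprev
      ((hF (n - 1) (by lia)).eq_of_src _ _)
    have h1 : q ≫ F.pOpcycles n = HomologicalComplex.opcyclesMap ψ n := by
      rw [← cancel_epi (K.pOpcycles n)]
      simp [q, F]
    rw [← cancel_mono (F.pOpcycles n), Category.assoc, h1, zero_comp]
    have := HomologicalComplex.homologyι_naturality ψ n
    rw [hψ, zero_comp] at this
    exact this.symm
  have hex : (ShortComplex.mk (K.homologyι n) (K.fromOpcycles n (n + 1)) (by simp)).Exact :=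
    ShortComplex.exact_of_f_is_kernel _ (K.homologyIsKernel n (n + 1) hnext)
  let s : K.X (n + 1) ⟶ F.X n := hex.descToInjective q hq
  have hs : K.d n (n + 1) ≫ s = ψ.f n := by
    rw [← K.p_fromOpcycles, Category.assoc]
    erw [hex.comp_descToInjective q hq]
    simp [q]
  let h (i j : ℤ) (r : (ComplexShape.up ℤ).Rel j i) : K.X i ⟶ F.X j :=
    if hj : j = n then (K.XIsoOfEq (by simp at r; lia)).hom ≫ s ≫ (F.XIsoOfEq hj.symm).hom else 0
  have : ψ = Homotopy.nullHomotopicMap' h := by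
    refine HomologicalComplex.hom_ext _ _ fun m ↦ ?_
    by_cases hm : m = n
    · subst hm
      rw [Homotopy.nullHomotopicMap'_f (k₂ := m - 1) (k₁ := m) (k₀ := m + 1) (by simp) (by simp)]
      simp [h, hs]
    · exact (hF m hm).eq_of_tgt _ _
  rw [this]
  exact ⟨Homotopy.nullHomotopy' h⟩

/-- Every morphism from the homology in degree `n` to an injective object is induced by a
morphism of complexes. -/
lemma exists_homologyMap_single_eq {K : CochainComplex C ℤ} {E : C} [Injective E]
    {n : ℤ} (g : K.homology n ⟶ E) :
    ∃ ψ : K ⟶ (HomologicalComplex.single C (.up ℤ) n).obj E,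
      HomologicalComplex.homologyMap ψ n ≫
        (HomologicalComplex.singleObjHomologySelfIso (.up ℤ) n E).hom = g := by
  let q : K.opcycles n ⟶ E := Injective.factorThru g (K.homologyι n)
  have hq : K.homologyι n ≫ q = g := Injective.comp_factorThru g (K.homologyι n)
  refine ⟨HomologicalComplex.mkHomToSingle (K.pOpcycles n ≫ q) (fun i _ ↦ by simp), ?_⟩
  rw [← cancel_epi (K.homologyπ n), HomologicalComplex.homologyπ_naturality_assoc,
    HomologicalComplex.homologyπ_singleObjHomologySelfIso_hom, ← hq,
    HomologicalComplex.singleObjCyclesSelfIso_hom, HomologicalComplex.cyclesMap_i_assoc]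
  simp

lemma exists_lift_of_comp_homologyπ_eq_zero {P : C} [Projective P] (L : CochainComplex C ℤ)
    {m n : ℤ} (hmn : m + 1 = n) (z : P ⟶ L.cycles n) (hz : z ≫ L.homologyπ n = 0) :
    ∃ s : P ⟶ L.X m, s ≫ L.d m n = z ≫ L.iCycles n := by
  have hex : (ShortComplex.mk (L.toCycles m n) (L.homologyπ n) (by simp)).Exact :=
    ShortComplex.exact_of_g_is_cokernel _ (L.homologyIsCokernel m n (by simp [← hmn]))
  refine ⟨hex.liftFromProjective z hz, ?_⟩
  rw [← L.toCycles_i m n, ← Category.assoc]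
  exact congr($(hex.liftFromProjective_comp z hz) ≫ L.iCycles n)

lemma exists_hom_of_isZero {σ L : CochainComplex C ℤ}
    (hσ : ∀ n : ℤ, n ≠ -1 → n ≠ 0 → IsZero (σ.X n))
    (a : σ.X (-1) ⟶ L.X (-1)) (b : σ.X 0 ⟶ L.X 0)
    (hab : a ≫ L.d (-1) 0 = σ.d (-1) 0 ≫ b) (hb : b ≫ L.d 0 1 = 0) :
    ∃ φ : σ ⟶ L, φ.f (-1) = a ∧ φ.f 0 = b := by
  let f (n : ℤ) : σ.X n ⟶ L.X n :=
    match n with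
    | .negSucc 0 => a
    | .ofNat 0 => b
    | _ => 0
  refine ⟨⟨f, fun i j hij ↦ ?_⟩, rfl, rfl⟩
  obtain rfl : i + 1 = j := by simpa using hij
  by_cases h1 : i = -1
  · subst h1
    exact hab
  by_cases h0 : i = 0
  · subst h0
    exact hb.trans (by rw [(hσ (0 + 1) (by simp) (by simp)).eq_of_tgt (σ.d 0 (0 + 1)) 0, zero_comp])
  exact (hσ i h1 h0).eq_of_src _ _

lemma nonempty_homotopy_zero_of_isZero {σ L : CochainComplex C ℤ}
    (hσ : ∀ n : ℤ, n ≠ -1 → n ≠ 0 → IsZero (σ.X n))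
    {φ : σ ⟶ L} (s : σ.X 0 ⟶ L.X (-1))
    (t : σ.X (-1) ⟶ L.X (-2)) (h0 : φ.f 0 = s ≫ L.d (-1) 0)
    (h1 : φ.f (-1) = σ.d (-1) 0 ≫ s + t ≫ L.d (-2) (-1)) : Nonempty (Homotopy φ 0) := by
  let h (i j : ℤ) (r : (ComplexShape.up ℤ).Rel j i) : σ.X i ⟶ L.X j :=
    if hi : i = 0 then
      (σ.XIsoOfEq hi).hom ≫ s ≫ (L.XIsoOfEq (by simp at r; lia)).hom
    else if hi' : i = -1 then
      (σ.XIsoOfEq hi').hom ≫ t ≫ (L.XIsoOfEq (by simp at r; lia)).hom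
    else 0
  have : φ = Homotopy.nullHomotopicMap' h := by
    refine HomologicalComplex.hom_ext _ _ fun m ↦ ?_
    by_cases hm : m = -1
    · subst hm
      rw [Homotopy.nullHomotopicMap'_f (k₂ := -2) (k₁ := -1) (k₀ := 0) (by simp) (by simp)]
      simp [h, h1]
    by_cases hm' : m = 0
    · subst hm'
      rw [Homotopy.nullHomotopicMap'_f (k₂ := -1) (k₁ := 0) (k₀ := 1) (by simp) (by simp)]
      simp [h, h0]
    · exact (hσ m hm hm').eq_of_src _ _
  rw [this]
  exact ⟨Homotopy.nullHomotopy' h⟩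

lemma exists_of_homotopy_zero {σ L : CochainComplex C ℤ}
    (hσ : ∀ n : ℤ, n ≠ -1 → n ≠ 0 → IsZero (σ.X n))
    {φ : σ ⟶ L} (H : Homotopy φ 0) :
    ∃ (s : σ.X 0 ⟶ L.X (-1)) (t : σ.X (-1) ⟶ L.X (-2)), φ.f 0 = s ≫ L.d (-1) 0 ∧
      φ.f (-1) = σ.d (-1) 0 ≫ s + t ≫ L.d (-2) (-1) := by
  refine ⟨H.hom 0 (-1), H.hom (-1) (-2), ?_, ?_⟩
  · rw [H.comm 0, dNext_eq _ (i' := 1) (by simp), prevD_eq _ (j' := -1) (by simp),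
      (hσ 1 (by simp) (by simp)).eq_of_tgt (σ.d 0 1) 0]
    simp
  · rw [H.comm (-1), dNext_eq _ (i' := 0) (by simp), prevD_eq _ (j' := -2) (by simp)]
    simp

lemma isKProjective_of_isZero {σ : CochainComplex C ℤ} (hP : ∀ n, Projective (σ.X n))
    (hσ : ∀ n : ℤ, n ≠ -1 → n ≠ 0 → IsZero (σ.X n)) : σ.IsKProjective := by
  have : σ.IsStrictlyLE 0 := by
    rw [CochainComplex.isStrictlyLE_iff]
    exact fun i hi ↦ hσ i (by lia) (by lia)
  exact CochainComplex.isKProjective_of_projective σ 0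

variable [HasDerivedCategory.{w} C]

lemma Q_map_surjective_of_isKInjective (K L : CochainComplex C ℤ) [L.IsKInjective] :
    Function.Surjective (DerivedCategory.Q.map : (K ⟶ L) → _) := by
  intro φ
  obtain ⟨g, hg⟩ := (CochainComplex.IsKInjective.Qh_map_bijective _ L).surjective
    ((DerivedCategory.quotientCompQhIso C).hom.app K ≫ φ ≫
      (DerivedCategory.quotientCompQhIso C).inv.app L)
  obtain ⟨f, rfl⟩ := (HomotopyCategory.quotient C (.up ℤ)).map_surjective g
  refine ⟨f, ?_⟩
  rw [← cancel_epi ((DerivedCategory.quotientCompQhIso C).hom.app K),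
    ← DerivedCategory.quotientCompQhIso_hom_naturality, hg]
  simp

lemma Q_map_surjective_of_isKProjective (K L : CochainComplex C ℤ) [K.IsKProjective] :
    Function.Surjective (DerivedCategory.Q.map : (K ⟶ L) → _) := by
  intro φ
  obtain ⟨g, hg⟩ := (CochainComplex.IsKProjective.Qh_map_bijective K _).surjective
    ((DerivedCategory.quotientCompQhIso C).hom.app K ≫ φ ≫
      (DerivedCategory.quotientCompQhIso C).inv.app L)
  obtain ⟨f, rfl⟩ := (HomotopyCategory.quotient C (.up ℤ)).map_surjective g
  refine ⟨f, ?_⟩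
  rw [← cancel_epi ((DerivedCategory.quotientCompQhIso C).hom.app K),
    ← DerivedCategory.quotientCompQhIso_hom_naturality, hg]
  simp

lemma Q_map_eq_zero_of_homotopy {K L : CochainComplex C ℤ} {f : K ⟶ L} (h : Homotopy f 0) :
    DerivedCategory.Q.map f = 0 := by
  rw [← cancel_epi ((DerivedCategory.quotientCompQhIso C).hom.app K),
    ← DerivedCategory.quotientCompQhIso_hom_naturality,
    HomotopyCategory.eq_of_homotopy _ _ h]
  simp

lemma nonempty_homotopy_of_Q_map_eq_zero {K L : CochainComplex C ℤ} [K.IsKProjective] {f : K ⟶ L}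
    (h : DerivedCategory.Q.map f = 0) : Nonempty (Homotopy f 0) := by
  refine ⟨HomotopyCategory.homotopyOfEq _ _
    ((CochainComplex.IsKProjective.Qh_map_bijective K _).injective ?_)⟩
  rw [← cancel_mono ((DerivedCategory.quotientCompQhIso C).hom.app L),
    DerivedCategory.quotientCompQhIso_hom_naturality, h]
  simp

/-- The homology of the image of a complex in the derived category. -/
noncomputable def homologyQIso (K : CochainComplex C ℤ) (n : ℤ) :
    (DerivedCategory.homologyFunctor C n).obj (DerivedCategory.Q.obj K) ≅ K.homology n :=
  (DerivedCategory.homologyFunctorFactors C n).app K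

lemma homologyQIso_hom_naturality {K L : CochainComplex C ℤ} (ψ : K ⟶ L) (n : ℤ) :
    (DerivedCategory.homologyFunctor C n).map (DerivedCategory.Q.map ψ) ≫ (homologyQIso L n).hom =
      (homologyQIso K n).hom ≫ HomologicalComplex.homologyMap ψ n :=
  (DerivedCategory.homologyFunctorFactors C n).hom.naturality ψ

lemma eq_zero_of_homologyFunctor_map_eq_zero {X : DerivedCategory C} {E : C} [Injective E] {n : ℤ}
    (φ : X ⟶ DerivedCategory.Q.obj ((HomologicalComplex.single C (.up ℤ) n).obj E))
    (hφ : (DerivedCategory.homologyFunctor C n).map φ = 0) : φ = 0 := by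
  have := isKInjective_single E n
  let e := DerivedCategory.Q.objObjPreimageIso X
  obtain ⟨ψ, hψ⟩ := Q_map_surjective_of_isKInjective _ _ (e.hom ≫ φ)
  have hh : HomologicalComplex.homologyMap ψ n = 0 := by
    rw [← cancel_epi (homologyQIso _ n).hom, ← homologyQIso_hom_naturality, hψ, Functor.map_comp,
      hφ, comp_zero, zero_comp, comp_zero]
  obtain ⟨H⟩ := nonempty_homotopy_zero_of_homologyMap_eq_zero ψ hh
  rw [← cancel_epi e.hom, ← hψ, Q_map_eq_zero_of_homotopy H, comp_zero]

/-- Homology in degree `n` turns a coproduct cofan into a jointly epimorphic family. -/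
lemma homologyFunctor_map_inj_jointly_epi [EnoughInjectives C] {J : Type*}
    {f : J → DerivedCategory C} {c : Cofan f} (hc : IsColimit c) (n : ℤ) {N : C}
    (g : (DerivedCategory.homologyFunctor C n).obj c.pt ⟶ N)
    (hg : ∀ j, (DerivedCategory.homologyFunctor C n).map (c.inj j) ≫ g = 0) : g = 0 := by
  let H := DerivedCategory.homologyFunctor C n
  let e := DerivedCategory.Q.objObjPreimageIso c.pt
  let a : (DerivedCategory.Q.objPreimage c.pt).homology n ≅ H.obj c.pt :=
    (homologyQIso _ n).symm ≪≫ H.mapIso e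
  obtain ⟨ψ, hψ⟩ := exists_homologyMap_single_eq (a.hom ≫ g ≫ Injective.ι N)
  let i := homologyQIso ((HomologicalComplex.single C (.up ℤ) n).obj (Injective.under N)) n ≪≫
    HomologicalComplex.singleObjHomologySelfIso (.up ℤ) n (Injective.under N)
  let φ : c.pt ⟶ _ := e.inv ≫ DerivedCategory.Q.map ψ
  have hφ : H.map φ ≫ i.hom = g ≫ Injective.ι N := by
    rw [← cancel_epi a.hom, ← hψ]
    simp only [a, φ, i, Iso.trans_hom, Iso.symm_hom, Functor.mapIso_hom, Category.assoc, H,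
      ← Functor.map_comp_assoc, Iso.hom_inv_id_assoc]
    rw [reassoc_of% homologyQIso_hom_naturality ψ n, Iso.inv_hom_id_assoc]
  have h0 : φ = 0 := Cofan.IsColimit.hom_ext hc _ _ fun j ↦ by
    rw [comp_zero]
    apply eq_zero_of_homologyFunctor_map_eq_zero
    rw [← cancel_mono i.hom, zero_comp, Functor.map_comp, Category.assoc, hφ,
      reassoc_of% hg j, zero_comp]
  rw [← cancel_mono (Injective.ι N), ← hφ, h0, Functor.map_zero, zero_comp, zero_comp]


/-- Vanishing of all morphisms in the derived category from a two-term complex of projectives to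
a complex `L`, expressed in terms of the homology of `L`. -/
lemma forall_Q_hom_eq_zero_iff {σ : CochainComplex C ℤ} (hP : ∀ n, Projective (σ.X n))
    (hσ : ∀ n : ℤ, n ≠ -1 → n ≠ 0 → IsZero (σ.X n)) (L : CochainComplex C ℤ) :
    (∀ f : DerivedCategory.Q.obj σ ⟶ DerivedCategory.Q.obj L, f = 0) ↔
      Function.Surjective (fun φ : σ.X 0 ⟶ L.homology (-1) ↦ σ.d (-1) 0 ≫ φ) ∧
        ∀ φ : σ.X 0 ⟶ L.homology 0, σ.d (-1) 0 ≫ φ = 0 → φ = 0 := by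
  have := isKProjective_of_isZero hP hσ
  have hn0 : (ComplexShape.up ℤ).next 0 = 1 := by simp
  have hn1 : (ComplexShape.up ℤ).next (-1) = 0 := by simp
  refine ⟨fun h ↦ ⟨fun α ↦ ?_, fun β hβ ↦ ?_⟩, fun ⟨hs, hi⟩ f ↦ ?_⟩
  · let a := Projective.factorThru α (L.homologyπ (-1))
    obtain ⟨φ, hφ1, hφ0⟩ := exists_hom_of_isZero hσ (a ≫ L.iCycles (-1)) 0 (by simp) (by simp)
    obtain ⟨H⟩ := nonempty_homotopy_of_Q_map_eq_zero (h (DerivedCategory.Q.map φ))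
    obtain ⟨s, t, h0, h1⟩ := exists_of_homotopy_zero hσ H
    rw [hφ0] at h0
    rw [hφ1] at h1
    refine ⟨L.liftCycles s 0 hn1 h0.symm ≫ L.homologyπ (-1), ?_⟩
    have h2 : a = σ.d (-1) 0 ≫ L.liftCycles s 0 hn1 h0.symm + t ≫ L.toCycles (-2) (-1) := by
      simp [← cancel_mono (L.iCycles (-1)), h1]
    have h3 : a ≫ L.homologyπ (-1) = α := Projective.factorThru_comp _ _
    rw [← h3, h2]
    simp
  · let b := Projective.factorThru β (L.homologyπ 0)
    have hb : b ≫ L.homologyπ 0 = β := Projective.factorThru_comp _ _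
    obtain ⟨a, ha⟩ := exists_lift_of_comp_homologyπ_eq_zero L (m := -1) (n := 0) (by simp)
      (σ.d (-1) 0 ≫ b) (by rw [Category.assoc, hb, hβ])
    obtain ⟨φ, hφ1, hφ0⟩ := exists_hom_of_isZero hσ a (b ≫ L.iCycles 0) (by simpa using ha)
      (by simp)
    obtain ⟨H⟩ := nonempty_homotopy_of_Q_map_eq_zero (h (DerivedCategory.Q.map φ))
    obtain ⟨s, t, h0, h1⟩ := exists_of_homotopy_zero hσ H
    have h2 : b = s ≫ L.toCycles (-1) 0 := by
      rw [← cancel_mono (L.iCycles 0), ← hφ0, h0]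
      simp
    rw [← hb, h2]
    simp
  · obtain ⟨φ, rfl⟩ := Q_map_surjective_of_isKProjective σ L f
    have hφ : φ.f 0 ≫ L.d 0 1 = 0 := by
      rw [φ.comm, (hσ 1 (by simp) (by simp)).eq_of_tgt (σ.d 0 1) 0, zero_comp]
    let b := L.liftCycles (φ.f 0) 1 hn0 hφ
    have hdb : σ.d (-1) 0 ≫ b = φ.f (-1) ≫ L.toCycles (-1) 0 := by
      simp [← cancel_mono (L.iCycles 0), b]
    obtain ⟨s, hs0⟩ := exists_lift_of_comp_homologyπ_eq_zero L (m := -1) (n := 0) (by simp) b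
      (hi _ (by rw [reassoc_of% hdb]; simp))
    have hs0' : φ.f 0 = s ≫ L.d (-1) 0 := by rw [hs0]; simp [b]
    let a := L.liftCycles (φ.f (-1) - σ.d (-1) 0 ≫ s) 0 hn1 (by simp [hs0'])
    obtain ⟨γ, hγ⟩ := hs (a ≫ L.homologyπ (-1))
    let c := Projective.factorThru γ (L.homologyπ (-1))
    have hc : c ≫ L.homologyπ (-1) = γ := Projective.factorThru_comp _ _
    obtain ⟨t, ht⟩ := exists_lift_of_comp_homologyπ_eq_zero L (m := -2) (n := -1) (by simp)
      (a - σ.d (-1) 0 ≫ c) (by simp [← hγ, hc])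
    obtain ⟨H⟩ := nonempty_homotopy_zero_of_isZero hσ (φ := φ) (s + c ≫ L.iCycles (-1)) t
      (by simp [hs0']) (by rw [ht]; simp [a])
    exact Q_map_eq_zero_of_homotopy H

end Abelian

section Projections

variable {C : Type*} [Category* C] [HasZeroMorphisms C] {J : Type*} {f : J → C} {c : Cofan f}

open Classical in
/-- The projection from a coproduct to one of its summands. -/
def cofanProj (hc : IsColimit c) (j : J) : c.pt ⟶ f j :=
  Cofan.IsColimit.desc hc (Pi.single j (𝟙 (f j)))

lemma inj_cofanProj_self (hc : IsColimit c) (j : J) : c.inj j ≫ cofanProj hc j = 𝟙 _ := by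
  simp [cofanProj]

lemma inj_cofanProj_of_ne (hc : IsColimit c) {j k : J} (h : j ≠ k) :
    c.inj j ≫ cofanProj hc k = 0 := by
  classical
  simp [cofanProj, Pi.single_eq_of_ne h]

end Projections

/-- The projections from a coproduct of modules are jointly monomorphic. -/
lemma cofanProj_jointly_mono {J : Type u} {f : J → ModuleCat.{u} R} {c : Cofan f}
    (hc : IsColimit c) {N : ModuleCat.{u} R} (g : N ⟶ c.pt)
    (hg : ∀ j, g ≫ cofanProj hc j = 0) : g = 0 := by
  classical
  let hd := ModuleCat.coproductCoconeIsColimit f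
  let e := hc.coconePointUniqueUpToIso hd
  let q (j : J) : (ModuleCat.coproductCocone f).pt ⟶ f j :=
    ModuleCat.ofHom (DirectSum.component R J (fun j ↦ f j) j)
  have he (j : J) : e.hom ≫ q j = cofanProj hc j := by
    refine Cofan.IsColimit.hom_ext hc _ _ fun k ↦ ?_
    have h1 : c.inj k ≫ e.hom = (ModuleCat.coproductCocone f).inj k :=
      hc.comp_coconePointUniqueUpToIso_hom hd ⟨k⟩
    rw [reassoc_of% h1]
    by_cases h : k = j
    · subst h
      rw [inj_cofanProj_self]
      ext x
      exact DirectSum.component.lof_self (M := fun j ↦ f j) R k x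
    · rw [inj_cofanProj_of_ne hc h]
      ext x
      exact (DirectSum.component.of (M := fun j ↦ f j) R j k x).trans (dif_neg h)
  rw [← cancel_mono e.hom, zero_comp]
  ext x
  refine DirectSum.ext_component R fun j ↦ ?_
  have h1 : (g ≫ e.hom) ≫ q j = 0 := by rw [Category.assoc, he, hg]
  exact congr($h1 x).trans (map_zero _).symm

lemma Yclass_closedUnderCoproducts {σ : CochainComplex (ModuleCat.{u} R) ℤ}
    (h : ClosedUnderCoproducts (Dclass σ)) : ClosedUnderCoproducts (Yclass σ) := by
  intro J f c hc hf
  refine ⟨?_, h J f c hc fun j ↦ (hf j).2⟩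
  intro φ ψ hφ
  rw [← sub_eq_zero]
  refine cofanProj_jointly_mono hc _ fun j ↦ (hf j).1 ?_
  simp only at hφ
  simp [Preadditive.sub_comp, reassoc_of% hφ]

/-- Membership in a class closed under coproducts for a module that is the internal direct sum of
a family indexed by a type in an arbitrary universe. -/
lemma ClosedUnderCoproducts.mem_of_jointly_epi {S : Set (ModuleCat.{u} R)}
    (hS : ClosedUnderCoproducts S) {J : Type*} {f : J → ModuleCat.{u} R} {M : ModuleCat.{u} R}
    (i : ∀ j, f j ⟶ M) (p : ∀ j, M ⟶ f j) (hip : ∀ j, i j ≫ p j = 𝟙 _)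
    (hip' : ∀ j k, j ≠ k → i j ≫ p k = 0)
    (hi : ∀ (N : ModuleCat.{u} R) (g : M ⟶ N), (∀ j, i j ≫ g = 0) → g = 0)
    (hf : ∀ j, f j ∈ S) : M ∈ S := by
  classical
  let J' := {j : J // Nontrivial (f j)}
  have : Small.{u} J' := by
    have hx (j : J') : ∃ x : f j.1, x ≠ 0 := by
      have := j.2
      exact exists_ne 0
    choose x hx using hx
    refine small_of_injective (β := M) (f := fun j ↦ i j.1 (x j)) fun j k hjk ↦ ?_
    by_contra hne
    refine hx k ?_
    have h1 := congr($(hip k.1) (x k))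
    have h2 := congr($(hip' j.1 k.1 fun h ↦ hne (Subtype.ext h)) (x j))
    simp only [ModuleCat.hom_comp, LinearMap.comp_apply] at h1 h2 hjk
    rw [← hjk] at h1
    exact h1.symm.trans h2
  let t : Shrink.{u} J' → J := fun j ↦ ((equivShrink J').symm j).1
  have ht : Function.Injective t := Subtype.val_injective.comp (equivShrink J').symm.injective
  let d := ModuleCat.coproductCocone fun j ↦ f (t j)
  let hd : IsColimit d := ModuleCat.coproductCoconeIsColimit fun j ↦ f (t j)
  let r : d.pt ⟶ M := Cofan.IsColimit.desc hd fun j ↦ i (t j)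
  have hr (j) : d.inj j ≫ r = i (t j) := by simp [r]
  have hrp (j) : r ≫ p (t j) = cofanProj hd j := by
    refine Cofan.IsColimit.hom_ext hd _ _ fun k ↦ ?_
    rw [reassoc_of% hr k]
    by_cases h : k = j
    · subst h
      rw [inj_cofanProj_self, hip]
    · rw [inj_cofanProj_of_ne hd h, hip' _ _ (ht.ne h)]
  have : Mono r := Preadditive.mono_of_cancel_zero _ fun g hg ↦
    cofanProj_jointly_mono hd g fun j ↦ by rw [← hrp, reassoc_of% hg, zero_comp]
  have : Epi r := Preadditive.epi_of_cancel_zero _ fun g hg ↦ hi _ g fun j ↦ by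
    by_cases hj : Nontrivial (f j)
    · obtain ⟨k, rfl⟩ : ∃ k, t k = j := ⟨equivShrink J' ⟨j, hj⟩, by simp [t]⟩
      rw [← hr, Category.assoc, hg, comp_zero]
    · rw [not_nontrivial_iff_subsingleton] at hj
      exact (ModuleCat.isZero_of_subsingleton (f j)).eq_of_src _ _
  have : IsIso r := isIso_of_mono_of_epi r
  exact hS _ _ (Cofan.mk M fun j ↦ i (t j))
    (hd.ofIsoColimit (Cofan.ext (asIso r) hr)) fun j ↦ hf (t j)

lemma mem_Dclass_of_iso {σ : CochainComplex (ModuleCat.{u} R) ℤ} {M N : ModuleCat.{u} R}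
    (e : M ≅ N) (hM : M ∈ Dclass σ) : N ∈ Dclass σ := by
  intro α
  obtain ⟨φ, hφ⟩ := hM (α ≫ e.inv)
  refine ⟨φ ≫ e.hom, ?_⟩
  simp only at hφ ⊢
  rw [reassoc_of% hφ, e.inv_hom_id, Category.comp_id]

/-- The class of modules `M` such that no nonzero morphism to `M` is killed by `σ` is invariant
under isomorphisms. -/
lemma eq_zero_of_comp_eq_zero_of_iso {σ : CochainComplex (ModuleCat.{u} R) ℤ}
    {M N : ModuleCat.{u} R} (e : M ≅ N) (hM : ∀ φ : σ.X 0 ⟶ M, σ.d (-1) 0 ≫ φ = 0 → φ = 0)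
    (φ : σ.X 0 ⟶ N) (hφ : σ.d (-1) 0 ≫ φ = 0) : φ = 0 := by
  rw [← cancel_mono e.inv, zero_comp]
  exact hM _ (by rw [reassoc_of% hφ, zero_comp])

lemma mem_Yclass_iff {σ : CochainComplex (ModuleCat.{u} R) ℤ} {M : ModuleCat.{u} R} :
    M ∈ Yclass σ ↔ M ∈ Dclass σ ∧ ∀ φ : σ.X 0 ⟶ M, σ.d (-1) 0 ≫ φ = 0 → φ = 0 := by
  refine ⟨fun h ↦ ⟨h.2, fun φ hφ ↦ h.1 (by simpa using hφ)⟩, fun h ↦ ⟨fun φ ψ hφ ↦ ?_, h.1⟩⟩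
  rw [← sub_eq_zero]
  exact h.2 _ (by simpa [sub_eq_zero] using hφ)

/-- The homology of the shift of an object of the derived category. -/
def homologyShiftIso (Z : DerivedCategory (ModuleCat.{u} R)) {n i m : ℤ} (h : i + n = m) :
    (DerivedCategory.homologyFunctor (ModuleCat.{u} R) n).obj (Z⟦i⟧) ≅
      (DerivedCategory.homologyFunctor (ModuleCat.{u} R) m).obj Z :=
  ((DerivedCategory.homologyFunctor (ModuleCat.{u} R) 0).shiftIso i n m h).app Z

lemma forall_hom_shift_eq_zero_iff {σ : CochainComplex (ModuleCat.{u} R) ℤ} (hσ : TwoTermProj σ)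
    (Z : DerivedCategory (ModuleCat.{u} R)) (i : ℤ) :
    (∀ f : DerivedCategory.Q.obj σ ⟶ Z⟦i⟧, f = 0) ↔
      (DerivedCategory.homologyFunctor (ModuleCat.{u} R) (i - 1)).obj Z ∈ Dclass σ ∧
        ∀ φ : σ.X 0 ⟶ (DerivedCategory.homologyFunctor (ModuleCat.{u} R) i).obj Z,
          σ.d (-1) 0 ≫ φ = 0 → φ = 0 := by
  let e := DerivedCategory.Q.objObjPreimageIso (Z⟦i⟧)
  let L := DerivedCategory.Q.objPreimage (Z⟦i⟧)
  let a {n m : ℤ} (h : i + n = m) :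
      L.homology n ≅ (DerivedCategory.homologyFunctor (ModuleCat.{u} R) m).obj Z :=
    (homologyQIso L n).symm ≪≫ (DerivedCategory.homologyFunctor _ n).mapIso e ≪≫
      homologyShiftIso Z h
  have h1 : (∀ f : DerivedCategory.Q.obj σ ⟶ Z⟦i⟧, f = 0) ↔
      ∀ f : DerivedCategory.Q.obj σ ⟶ DerivedCategory.Q.obj L, f = 0 := by
    refine ⟨fun h f ↦ ?_, fun h f ↦ ?_⟩
    · rw [← cancel_mono e.hom, h (f ≫ e.hom), zero_comp]
    · rw [← cancel_mono e.inv, h (f ≫ e.inv), zero_comp]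
  rw [h1, forall_Q_hom_eq_zero_iff hσ.1 hσ.2]
  exact ⟨fun h ↦ ⟨mem_Dclass_of_iso (a (by lia)) h.1,
      eq_zero_of_comp_eq_zero_of_iso (a (by lia)) h.2⟩,
    fun h ↦ ⟨mem_Dclass_of_iso (a (by lia)).symm h.1,
      eq_zero_of_comp_eq_zero_of_iso (a (by lia)).symm h.2⟩⟩

/-- The class `σ^{⊥>0}` in terms of homology. -/
lemma forall_pos_hom_shift_eq_zero_iff {σ : CochainComplex (ModuleCat.{u} R) ℤ}
    (hσ : TwoTermProj σ) (Z : DerivedCategory (ModuleCat.{u} R)) :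
    (∀ i : ℤ, 0 < i → ∀ f : DerivedCategory.Q.obj σ ⟶ Z⟦i⟧, f = 0) ↔
      (DerivedCategory.homologyFunctor (ModuleCat.{u} R) 0).obj Z ∈ Dclass σ ∧
        ∀ i : ℤ, 0 < i →
          (DerivedCategory.homologyFunctor (ModuleCat.{u} R) i).obj Z ∈ Yclass σ := by
  simp only [forall_hom_shift_eq_zero_iff hσ, mem_Yclass_iff]
  refine ⟨fun h ↦ ⟨(h 1 one_pos).1, fun i hi ↦ ⟨?_, (h i hi).2⟩⟩,
    fun h i hi ↦ ⟨?_, (h.2 i hi).2⟩⟩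
  · simpa using (h (i + 1) (by lia)).1
  · obtain rfl | hi' : i = 1 ∨ 0 < i - 1 := by lia
    · exact h.1
    · exact (h.2 (i - 1) hi').1

/-- A class of modules closed under coproducts contains the homology of a coproduct in the derived
category as soon as it contains the homology of the summands. -/
lemma ClosedUnderCoproducts.homology_mem {S : Set (ModuleCat.{u} R)}
    (hS : ClosedUnderCoproducts S) {J : Type*} {f : J → DerivedCategory (ModuleCat.{u} R)}
    {c : Cofan f} (hc : IsColimit c) (n : ℤ)
    (hf : ∀ j, (DerivedCategory.homologyFunctor (ModuleCat.{u} R) n).obj (f j) ∈ S) :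
    (DerivedCategory.homologyFunctor (ModuleCat.{u} R) n).obj c.pt ∈ S := by
  refine hS.mem_of_jointly_epi
    (fun j ↦ (DerivedCategory.homologyFunctor _ n).map (c.inj j))
    (fun j ↦ (DerivedCategory.homologyFunctor _ n).map (cofanProj hc j))
    (fun j ↦ ?_) (fun j k hjk ↦ ?_)
    (fun N g hg ↦ homologyFunctor_map_inj_jointly_epi hc n g hg) hf
  · rw [← Functor.map_comp, inj_cofanProj_self, CategoryTheory.Functor.map_id]
  · rw [← Functor.map_comp, inj_cofanProj_of_ne hc hjk, Functor.map_zero]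

/-- **Corollary 1.24**: if `D_σ` is closed under coproducts, then so are `Y_σ` and
`σ^{⊥>0}`. -/
theorem Yclass_perpGT_closedUnderCoproducts
    (σ : CochainComplex (ModuleCat.{u} R) ℤ) (hσ : TwoTermProj σ)
    (T : ModuleCat.{u} R) (hT : Nonempty (σ.homology 0 ≅ T))
    (h : ClosedUnderCoproducts (Dclass σ)) :
    ClosedUnderCoproducts (Yclass σ) ∧
    ClosedUnderCoproducts
      {Z : DerivedCategory (ModuleCat.{u} R) |
        ∀ i : ℤ, 0 < i → ∀ f : DerivedCategory.Q.obj σ ⟶ Z⟦i⟧, f = 0} := by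
  have hY := Yclass_closedUnderCoproducts h
  refine ⟨hY, fun J f c hc hf ↦ ?_⟩
  simp only [Set.mem_ofPred_eq, forall_pos_hom_shift_eq_zero_iff hσ] at hf ⊢
  exact ⟨h.homology_mem hc 0 fun j ↦ (hf j).1,
    fun i hi ↦ hY.homology_mem hc i fun j ↦ (hf j).2 i hi⟩

end

end Glue
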